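/- For all positive integers k and p, the number of domino tilings of the region D(k,k+1,p) is odd. -/

import Mathlib

/-- Two cells of `ℤ × ℤ` are adjacent if they differ by `(1,0)` or `(0,1)`. -/
def Adjacent (a b : ℤ × ℤ) : Prop :=
  (a.1 = b.1 ∧ (a.2 = b.2 + 1 ∨ b.2 = a.2 + 1)) ∨
  (a.2 = b.2 ∧ (a.1 = b.1 + 1 ∨ b.1 = a.1 + 1))

/-- `T` is a domino tiling of `R`: a partition of `R` into two-element sets of adjacent cells. -/
def IsDominoTiling (R : Set (ℤ × ℤ)) (T : Set (Set (ℤ × ℤ))) : Prop :=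
  (∀ d ∈ T, ∃ a b, Adjacent a b ∧ d = {a, b}) ∧
  T.PairwiseDisjoint id ∧
  ⋃₀ T = R

/-- The number of domino tilings of `R`. -/
noncomputable def numTilings (R : Set (ℤ × ℤ)) : ℕ :=
  Nat.card {T : Set (Set (ℤ × ℤ)) // IsDominoTiling R T}

/-- The region `D(i,j,p)`: rows `r = 0, …, i+2p-3` from top to bottom of lengths
`j, j+2, …, j+2(p-2)`, then `i` rows of length `j+2(p-1)`, then `j+2(p-2), …, j+2, j`,
centers aligned. -/
def Dreg (i j p : ℕ) : Set (ℤ × ℤ) :=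
  {q | 0 ≤ q.2 ∧ q.2 ≤ (i : ℤ) + 2 * p - 3 ∧
    (p : ℤ) - 1 - min (min q.2 ((p : ℤ) - 1)) ((i : ℤ) + 2 * p - 3 - q.2) ≤ q.1 ∧
    q.1 ≤ (p : ℤ) - 2 + j + min (min q.2 ((p : ℤ) - 1)) ((i : ℤ) + 2 * p - 3 - q.2)}

theorem rect_sum (h : ℤ → ℤ → ZMod 2) (u v : ℤ) (m n : ℕ)
    (H : ∀ a b : ℕ, a < m → b < n →
      h (u + 2 * a) (v + 2 * b) + h (u + 2 * a + 2) (v + 2 * b) +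
      h (u + 2 * a) (v + 2 * b + 2) + h (u + 2 * a + 2) (v + 2 * b + 2) = 0) :
    h u v + h (u + 2 * m) v + h u (v + 2 * n) + h (u + 2 * m) (v + 2 * n) = 0 := by
  have two : ∀ a : ZMod 2, a + a = 0 := by decide
  have step : ∀ a : ℕ, a < m → ∀ n' : ℕ, n' ≤ n →
      h (u + 2 * a) v + h (u + 2 * a + 2) v + h (u + 2 * a) (v + 2 * n') +
        h (u + 2 * a + 2) (v + 2 * n') = 0 := by
    intro a ha n'
    induction n' with
    | zero =>
      intro _
      simp only [Nat.cast_zero, mul_zero, add_zero]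
      linear_combination two (h (u + 2 * a) v) + two (h (u + 2 * a + 2) v)
    | succ b ih =>
      intro hb
      have h1 := ih (by omega)
      have h2 := H a b ha (by omega)
      have e : v + 2 * ((b + 1 : ℕ) : ℤ) = v + 2 * b + 2 := by push_cast; ring
      rw [e]
      linear_combination h1 + h2 - two (h (u + 2 * a) (v + 2 * b))
        - two (h (u + 2 * a + 2) (v + 2 * b))
  have key : ∀ m' : ℕ, m' ≤ m →
      h u v + h (u + 2 * m') v + h u (v + 2 * n) + h (u + 2 * m') (v + 2 * n) = 0 := by
    intro m'
    induction m' with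
    | zero =>
      intro _
      simp only [Nat.cast_zero, mul_zero, add_zero]
      linear_combination two (h u v) + two (h u (v + 2 * n))
    | succ b ih =>
      intro hb
      have h1 := ih (by omega)
      have h2 := step b (by omega) n le_rfl
      have e : u + 2 * ((b + 1 : ℕ) : ℤ) = u + 2 * b + 2 := by push_cast; ring
      rw [e]
      linear_combination h1 + h2 - two (h (u + 2 * b) v) - two (h (u + 2 * b) (v + 2 * n))
  exact key m le_rfl

/-- closed octagon in rotated coordinates (u = x+y, v = x-y) -/
def Oct (k p : ℤ) (u v : ℤ) : Prop :=
  p - 2 ≤ u ∧ u ≤ 3 * p + 2 * k - 3 ∧ 1 - p - k ≤ v ∧ v ≤ p + k ∧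
  -2 ≤ u + v ∧ u + v ≤ 4 * p + 2 * k - 2 ∧ -2 ≤ u - v ∧ u - v ≤ 2 * k + 4 * p - 4

theorem mem_Dreg_iff (k p : ℕ) (hk : 0 < k) (hp : 0 < p) (x y : ℤ) :
    (x, y) ∈ Dreg k (k + 1) p ↔
      (0 ≤ x ∧ x ≤ 2 * p - 2 + k ∧ 0 ≤ y ∧ y ≤ k + 2 * p - 3 ∧
       (p : ℤ) - 2 < x + y ∧ x + y < 3 * p + 2 * k - 3 ∧ 1 - p - k < x - y ∧ x - y < p + k) := by
  simp only [Dreg, Set.mem_ofPred_eq]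
  push_cast
  omega

theorem rect_oct (k p : ℤ) (h : ℤ → ℤ → ZMod 2)
    (H : ∀ u v, (u - p) % 2 = 0 → (v - p) % 2 = 0 → Oct k p u v → Oct k p (u+2) v →
      Oct k p u (v+2) → Oct k p (u+2) (v+2) →
      h u v + h (u+2) v + h u (v+2) + h (u+2) (v+2) = 0)
    (u v u' v' : ℤ) (hu : (u - p) % 2 = 0) (hv : (v - p) % 2 = 0) (hu' : (u' - p) % 2 = 0)
    (hv' : (v' - p) % 2 = 0) (h1 : u ≤ u') (h2 : v ≤ v')
    (o1 : Oct k p u v) (o2 : Oct k p u' v) (o3 : Oct k p u v') (o4 : Oct k p u' v') :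
    h u v + h u' v + h u v' + h u' v' = 0 := by
  obtain ⟨m, rfl⟩ : ∃ m : ℕ, u' = u + 2 * m := ⟨((u' - u) / 2).toNat, by omega⟩
  obtain ⟨n, rfl⟩ : ∃ n : ℕ, v' = v + 2 * n := ⟨((v' - v) / 2).toNat, by omega⟩
  apply rect_sum
  intro a b ha hb
  unfold Oct at *
  apply H <;> omega

theorem kernel_oct (k p : ℤ) (hk : 0 < k) (hp : 0 < p) (h : ℤ → ℤ → ZMod 2)
    (H : ∀ u v, (u - p) % 2 = 0 → (v - p) % 2 = 0 → Oct k p u v → Oct k p (u+2) v →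
      Oct k p u (v+2) → Oct k p (u+2) (v+2) →
      h u v + h (u+2) v + h u (v+2) + h (u+2) (v+2) = 0)
    (B : ∀ u v, (u - p) % 2 = 0 → (v - p) % 2 = 0 → Oct k p u v →
      (u = p - 2 ∨ u = 3 * p + 2 * k - 3 ∨ v = 1 - p - k ∨ v = p + k ∨
       u + v = -2 ∨ u + v = 4 * p + 2 * k - 2 ∨ u - v = -2 ∨ u - v = 2 * k + 4 * p - 4) →
      h u v = 0)
    (u v : ℤ) (hu : (u - p) % 2 = 0) (hv : (v - p) % 2 = 0) (o : Oct k p u v) : h u v = 0 := by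
  have two : ∀ a : ZMod 2, a + a = 0 := by decide
  have eqz : ∀ a b : ZMod 2, a + b = 0 → a = b := by decide
  obtain ⟨w, hw1, hw2, hw3⟩ : ∃ w : ℤ, (w - p) % 2 = 0 ∧ p + k - 2 ≤ w ∧ w ≤ 3 * p + k - 3 := by
    rcases Int.emod_two_eq_zero_or_one k with hk2 | hk2
    · exact ⟨p + k - 2, by omega, by omega, by omega⟩
    · exact ⟨p + k - 1, by omega, by omega, by omega⟩
  obtain ⟨F, hF⟩ : ∃ F : ℤ → ZMod 2, ∀ u, F u = h u p + h w p := ⟨_, fun _ => rfl⟩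
  obtain ⟨G, hG⟩ : ∃ G : ℤ → ZMod 2, ∀ v, G v = h w v := ⟨_, fun _ => rfl⟩
  have dec : ∀ u v, (u - p) % 2 = 0 → (v - p) % 2 = 0 → Oct k p u v → h u v = F u + G v := by
    intro u v hu hv o
    have a1 : Oct k p u p := by unfold Oct at *; omega
    have a2 : Oct k p w v := by unfold Oct at *; omega
    have a3 : Oct k p w p := by unfold Oct at *; omega
    rw [hF, hG]
    apply eqz
    rcases le_total u w with c1 | c1 <;> rcases le_total v p with c2 | c2
    · linear_combination rect_oct k p h H u v w p hu hv hw1 (by simp) c1 c2 o a2 a1 a3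
    · linear_combination rect_oct k p h H u p w v hu (by simp) hw1 hv c1 c2 a1 a3 o a2
    · linear_combination rect_oct k p h H w v u p hw1 hv hu (by simp) c1 c2 a2 o a3 a1
    · linear_combination rect_oct k p h H w p u v hw1 (by simp) hu hv c1 c2 a3 a1 a2 o
  have E : ∀ u v, (u - p) % 2 = 0 → (v - p) % 2 = 0 → Oct k p u v →
      (u = p - 2 ∨ u = 3 * p + 2 * k - 3 ∨ v = 1 - p - k ∨ v = p + k ∨
       u + v = -2 ∨ u + v = 4 * p + 2 * k - 2 ∨ u - v = -2 ∨ u - v = 2 * k + 4 * p - 4) →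
      F u = G v := by
    intro u v hu hv o b
    apply eqz
    rw [← dec u v hu hv o]
    exact B u v hu hv o b
  have S : ∀ u, (u - p) % 2 = 0 → p ≤ u → u ≤ p - 2 + k → F u = F (u - 2) := by
    intro u hu c1 c2
    rw [E u (u+2) (by omega) (by omega) (by unfold Oct; omega) (by omega),
      ← E (4*p+2*k-4-u) (u+2) (by omega) (by omega) (by unfold Oct; omega) (by omega),
      E (4*p+2*k-4-u) (-u) (by omega) (by omega) (by unfold Oct; omega) (by omega),
      ← E (u-2) (-u) (by omega) (by omega) (by unfold Oct; omega) (by omega)]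
  have S2 : ∀ n : ℕ, p - 2 + 2 * n ≤ p - 2 + k → F (p - 2 + 2 * n) = F (p - 2) := by
    intro n
    induction n with
    | zero => simp
    | succ n ih =>
      intro c
      rw [S _ (by omega) (by omega) c, ← ih (by omega)]
      congr 1; push_cast; ring
  have S3 : ∀ u, (u - p) % 2 = 0 → p - 2 ≤ u → u ≤ p - 2 + k → F u = F (p - 2) := by
    intro u hu c1 c2
    have := S2 ((u - (p - 2)) / 2).toNat (by omega)
    rwa [show p - 2 + 2 * (((u - (p - 2)) / 2).toNat : ℤ) = u by omega] at this
  have G1 : ∀ v, (v - p) % 2 = 0 → 1 - p - k ≤ v → v ≤ p + k → G v = F (p - 2) := by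
    intro v hv c1 c2
    rcases lt_or_ge v (-p) with c3 | c3
    · rw [← E (-2-v) v (by omega) (by omega) (by unfold Oct; omega) (by omega)]
      exact S3 _ (by omega) (by omega) (by omega)
    rcases lt_or_ge v p with c4 | c4
    · rw [← E (p-2) v (by omega) (by omega) (by unfold Oct; omega) (by omega)]
    · rw [← E (v-2) v (by omega) (by omega) (by unfold Oct; omega) (by omega)]
      exact S3 _ (by omega) (by omega) (by omega)
  have F1 : ∀ u, (u - p) % 2 = 0 → p - 2 ≤ u → u ≤ 3 * p + 2 * k - 3 → F u = F (p - 2) := by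
    intro u hu c1 c2
    rcases le_or_gt u (p - 2 + k) with c3 | c3
    · exact S3 u hu c1 c3
    rcases le_or_gt (3 * p + k - 3) u with c4 | c4
    · rw [E u (u-2*k-4*p+4) (by omega) (by omega) (by unfold Oct; omega) (by omega)]
      exact G1 _ (by omega) (by omega) (by omega)
    rcases Int.emod_two_eq_zero_or_one k with hk2 | hk2
    · rw [E u (p+k) (by omega) (by omega) (by unfold Oct; omega) (by omega)]
      exact G1 _ (by omega) (by omega) (by omega)
    · rw [E u (1-p-k) (by omega) (by omega) (by unfold Oct; omega) (by omega)]
      exact G1 _ (by omega) (by omega) (by omega)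
  rw [dec u v hu hv o, F1 u hu o.1 o.2.1, G1 v hv o.2.2.1 o.2.2.2.1]
  exact two _

/-- `f` is in the mod 2 kernel of the adjacency matrix of `R`. -/
def InKer (R : Set (ℤ × ℤ)) (f : ℤ → ℤ → ZMod 2) : Prop :=
  (∀ x y, (x, y) ∉ R → f x y = 0) ∧
  ∀ x y, (x, y) ∈ R → f (x+1) y + f (x-1) y + f x (y+1) + f x (y-1) = 0

theorem ker_class (k p : ℕ) (hk : 0 < k) (hp : 0 < p) (f : ℤ → ℤ → ZMod 2)
    (hf : InKer (Dreg k (k+1) p) f) (x y : ℤ) (hxy : (x + y - p) % 2 = 0) : f x y = 0 := by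
  by_cases hR : (x, y) ∈ Dreg k (k+1) p
  swap
  · exact hf.1 x y hR
  rw [mem_Dreg_iff k p hk hp] at hR
  have := kernel_oct k p (by omega) (by omega) (fun u v => f ((u+v)/2) ((u-v)/2)) ?_ ?_ (x+y) (x-y)
    (by omega) (by omega) (by unfold Oct; omega)
  · rwa [show (x + y + (x - y)) / 2 = x by omega, show (x + y - (x - y)) / 2 = y by omega] at this
  · intro u v hu hv o1 o2 o3 o4
    have hm : ((u+v)/2+1, (u-v)/2) ∈ Dreg k (k+1) p := by
      rw [mem_Dreg_iff k p hk hp]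
      unfold Oct at *
      omega
    have := hf.2 _ _ hm
    rw [show (u+2+v)/2 = (u+v)/2+1 by omega, show (u+2-v)/2 = (u-v)/2+1 by omega,
      show (u+(v+2))/2 = (u+v)/2+1 by omega, show (u-(v+2))/2 = (u-v)/2-1 by omega,
      show (u+2+(v+2))/2 = (u+v)/2+1+1 by omega, show (u+2-(v+2))/2 = (u-v)/2 by omega]
    rw [show (u+v)/2+1-1 = (u+v)/2 by omega] at this
    linear_combination this
  · intro u v hu hv o b
    apply hf.1
    rw [mem_Dreg_iff k p hk hp]
    omega

theorem ker_trivial (k p : ℕ) (hk : 0 < k) (hp : 0 < p) (f : ℤ → ℤ → ZMod 2)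
    (hf : InKer (Dreg k (k+1) p) f) (x y : ℤ) : f x y = 0 := by
  rcases Int.emod_two_eq_zero_or_one (x + y - p) with h | h
  · exact ker_class k p hk hp f hf x y h
  rcases Int.emod_two_eq_zero_or_one k with hk2 | hk2
  · have := ker_class k p hk hp (fun x y => f x (k+2*p-3-y)) ⟨?_, ?_⟩ x (k+2*p-3-y) (by omega)
    · simpa using this
    · intro x y hxy
      apply hf.1
      rw [mem_Dreg_iff k p hk hp] at *
      omega
    · intro x y hxy
      have := hf.2 x (k+2*p-3-y) (by rw [mem_Dreg_iff k p hk hp] at *; omega)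
      simp only
      rw [show (k:ℤ)+2*p-3-(y+1) = k+2*p-3-y-1 by ring,
        show (k:ℤ)+2*p-3-(y-1) = k+2*p-3-y+1 by ring]
      linear_combination this
  · have := ker_class k p hk hp (fun x y => f (2*p-2+k-x) y) ⟨?_, ?_⟩ (2*p-2+k-x) y (by omega)
    · simpa using this
    · intro x y hxy
      apply hf.1
      rw [mem_Dreg_iff k p hk hp] at *
      omega
    · intro x y hxy
      have := hf.2 (2*p-2+k-x) y (by rw [mem_Dreg_iff k p hk hp] at *; omega)
      simp only
      rw [show 2*(p:ℤ)-2+k-(x+1) = 2*p-2+k-x-1 by ring,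
        show 2*(p:ℤ)-2+k-(x-1) = 2*p-2+k-x+1 by ring]
      linear_combination this

theorem Adjacent.symm' {a b : ℤ × ℤ} (h : Adjacent a b) : Adjacent b a := by
  unfold Adjacent at *; omega

theorem Adjacent.ne' {a b : ℤ × ℤ} (h : Adjacent a b) : a ≠ b := by
  rintro rfl
  unfold Adjacent at *; omega

/-- The tiling of an involution. -/
def tilingOf {R : Set (ℤ × ℤ)} (σ : Equiv.Perm R) : Set (Set (ℤ × ℤ)) :=
  Set.range fun x : R => ({(x : ℤ × ℤ), (σ x : ℤ × ℤ)} : Set (ℤ × ℤ))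

theorem tilingOf_isTiling {R : Set (ℤ × ℤ)} (σ : Equiv.Perm R)
    (h1 : ∀ x, Adjacent (σ x) x) (h2 : ∀ x, σ (σ x) = x) : IsDominoTiling R (tilingOf σ) := by
  refine ⟨?_, ?_, ?_⟩
  · rintro d ⟨x, rfl⟩
    exact ⟨x, σ x, (h1 x).symm', rfl⟩
  · rintro _ ⟨x, rfl⟩ _ ⟨y, rfl⟩ hne
    simp only [Function.onFun, id]
    rw [Set.disjoint_left]
    intro a ha hb
    apply hne
    simp only [Set.mem_insert_iff, Set.mem_singleton_iff] at ha hb ⊢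
    rcases ha with ha | ha <;> rcases hb with hb | hb
    · have : x = y := Subtype.ext (ha.symm.trans hb)
      rw [this]
    · have : x = σ y := Subtype.ext (ha.symm.trans hb)
      rw [this, h2, Set.pair_comm]
    · have : σ x = y := Subtype.ext (ha.symm.trans hb)
      rw [← this, h2, Set.pair_comm]
    · have : σ x = σ y := Subtype.ext (ha.symm.trans hb)
      rw [σ.injective this]
  · ext a
    simp only [tilingOf, Set.mem_sUnion, Set.mem_range]
    constructor
    · rintro ⟨_, ⟨x, rfl⟩, ha⟩
      rcases ha with ha | ha
      · rw [ha]; exact x.2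
      · rw [ha]; exact (σ x).2
    · intro ha
      exact ⟨_, ⟨⟨a, ha⟩, rfl⟩, by simp⟩

theorem tilingOf_inj {R : Set (ℤ × ℤ)} (σ τ : Equiv.Perm R)
    (h1 : ∀ x, Adjacent (σ x) x) (t2 : ∀ x, τ (τ x) = x)
    (h : tilingOf σ = tilingOf τ) : σ = τ := by
  ext1 x
  have : ({(x : ℤ × ℤ), (σ x : ℤ × ℤ)} : Set (ℤ × ℤ)) ∈ tilingOf τ := h ▸ ⟨x, rfl⟩
  obtain ⟨y, hy⟩ := this
  simp only at hy
  have ne := (h1 x).ne'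
  have m1 : (x : ℤ × ℤ) ∈ ({(y : ℤ × ℤ), (τ y : ℤ × ℤ)} : Set (ℤ × ℤ)) := hy ▸ by simp
  have m2 : (σ x : ℤ × ℤ) ∈ ({(y : ℤ × ℤ), (τ y : ℤ × ℤ)} : Set (ℤ × ℤ)) := hy ▸ by simp
  simp only [Set.mem_insert_iff, Set.mem_singleton_iff, ← Subtype.ext_iff] at m1 m2
  have ne' : σ x ≠ x := fun e => ne (by rw [e])
  rcases m1 with m1 | m1 <;> rcases m2 with m2 | m2
  · exact absurd (m2.trans m1.symm) ne'
  · rw [m2, m1]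
  · exact m2.trans ((t2 y).symm.trans (by rw [← m1]))
  · exact absurd (m2.trans m1.symm) ne'

theorem tilingOf_surj {R : Set (ℤ × ℤ)} (T : Set (Set (ℤ × ℤ))) (hT : IsDominoTiling R T) :
    ∃ σ : Equiv.Perm R, (∀ x, Adjacent (σ x) x) ∧ (∀ x, σ (σ x) = x) ∧ tilingOf σ = T := by
  obtain ⟨hd, hdis, hU⟩ := hT
  have ex : ∀ x : R, ∃ y : R, Adjacent y x ∧ ({(x : ℤ × ℤ), (y : ℤ × ℤ)} : Set (ℤ × ℤ)) ∈ T := by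
    rintro ⟨x, hx⟩
    have hx' := hx
    rw [← hU] at hx'
    obtain ⟨d, hdT, hxd⟩ := hx'
    obtain ⟨a, b, hab, rfl⟩ := hd d hdT
    have ha : a ∈ R := hU ▸ ⟨_, hdT, by simp⟩
    have hb : b ∈ R := hU ▸ ⟨_, hdT, by simp⟩
    rcases hxd with rfl | hxd
    · exact ⟨⟨b, hb⟩, hab.symm', hdT⟩
    · obtain rfl : x = b := hxd
      exact ⟨⟨a, ha⟩, hab, by rw [Set.pair_comm]; exact hdT⟩
  choose s hs1 hs2 using ex
  have uniq : ∀ d ∈ T, ∀ e ∈ T, ∀ a, a ∈ d → a ∈ e → d = e := by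
    intro d hd e he a ha hb
    by_contra hne
    exact Set.disjoint_left.1 (hdis hd he hne) ha hb
  have inv : ∀ x, s (s x) = x := by
    intro x
    have e := uniq _ (hs2 x) _ (hs2 (s x)) (s x) (by simp) (by simp)
    have m : (x : ℤ × ℤ) ∈ ({(s x : ℤ × ℤ), (s (s x) : ℤ × ℤ)} : Set (ℤ × ℤ)) := e ▸ by simp
    rcases m with m | m
    · exact absurd m.symm (hs1 x).ne'
    · exact Subtype.ext (Eq.symm m)
  refine ⟨⟨s, s, inv, inv⟩, hs1, inv, ?_⟩
  ext d
  constructor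
  · rintro ⟨x, rfl⟩
    exact hs2 x
  · intro hdT
    obtain ⟨a, b, hab, rfl⟩ := hd d hdT
    have ha : a ∈ R := hU ▸ ⟨_, hdT, by simp⟩
    exact ⟨⟨a, ha⟩, uniq _ (hs2 ⟨a, ha⟩) _ hdT a (by simp) (by simp)⟩

open Classical in
/-- adjacency matrix mod 2 -/
noncomputable def adjM (R : Set (ℤ × ℤ)) : Matrix R R (ZMod 2) :=
  fun a b => if Adjacent a b then 1 else 0

open Classical in
theorem det_adjM (R : Set (ℤ × ℤ)) [Fintype R] : (adjM R).det = (numTilings R : ZMod 2) := by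
  have sgn : ∀ (e : ℤˣ) (z : ZMod 2), e • z = z := by
    intro e z
    rcases Int.units_eq_one_or e with rfl | rfl
    · simp
    · rw [Units.neg_smul, one_smul]; revert z; decide
  let X := {σ : Equiv.Perm R // ∀ x, Adjacent (σ x) x}
  have e1 : (adjM R).det = (Fintype.card X : ZMod 2) := by
    rw [Matrix.det_apply, Fintype.card_subtype, Finset.card_filter]
    push_cast
    apply Finset.sum_congr rfl
    intro σ _
    rw [sgn]
    simp only [adjM]
    rw [Finset.prod_ite_zero]
    simp
  let ι : Function.End X := fun σ => ⟨σ.1⁻¹, fun x => by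
        have := (σ.2 (σ.1⁻¹ x)).symm'
        simpa using this⟩
  have hι : ι ^ (2 ^ 1) = 1 := by
    rw [pow_one, pow_two]
    funext σ
    exact Subtype.ext (inv_inv σ.1)
  haveI : Fact (Nat.Prime 2) := ⟨Nat.prime_two⟩
  have e2 := Equiv.Perm.card_fixedPoints_modEq (p := 2) (n := 1) hι
  rw [e1, (ZMod.natCast_eq_natCast_iff _ _ 2).2 e2]
  congr 1
  rw [numTilings, ← Nat.card_eq_fintype_card]
  have fx : ∀ σ : Function.fixedPoints ι, ∀ x, σ.1.1 (σ.1.1 x) = x := by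
    intro σ x
    have h : (σ.1.1)⁻¹ = σ.1.1 := congrArg Subtype.val σ.2
    conv_lhs => rw [← h]
    rw [h]
    nth_rw 1 [← h]
    simp
  refine Nat.card_congr (Equiv.ofBijective (fun σ : Function.fixedPoints ι =>
    ⟨tilingOf σ.1.1, tilingOf_isTiling _ σ.1.2 (fx σ)⟩) ⟨?_, ?_⟩)
  · intro σ τ h
    exact Subtype.ext (Subtype.ext
      (tilingOf_inj _ _ σ.1.2 (fx τ) (congrArg Subtype.val h)))
  · rintro ⟨T, hT⟩
    obtain ⟨σ, h1, h2, h3⟩ := tilingOf_surj T hT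
    refine ⟨⟨⟨σ, h1⟩, ?_⟩, Subtype.ext h3⟩
    apply Subtype.ext
    change σ⁻¹ = σ
    ext1 x
    rw [Equiv.Perm.inv_eq_iff_eq, h2]

theorem finite_Dreg (k p : ℕ) (hk : 0 < k) (hp : 0 < p) : (Dreg k (k+1) p).Finite := by
  apply (Set.finite_Icc ((0 : ℤ), (0 : ℤ)) ((2 * p - 2 + k : ℤ), (k + 2 * p - 3 : ℤ))).subset
  rintro ⟨x, y⟩ h
  rw [mem_Dreg_iff k p hk hp] at h
  simp only [Set.mem_Icc, Prod.mk_le_mk]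
  omega

open Classical in
theorem inKer_of_mulVec (R : Set (ℤ × ℤ)) [Fintype R] (g : R → ZMod 2)
    (hg : (adjM R).mulVec g = 0) :
    InKer R (fun x y => if h : (x, y) ∈ R then g ⟨(x, y), h⟩ else 0) := by
  refine ⟨fun x y h => by simp [h], ?_⟩
  intro x y h
  have h0 := congrFun hg ⟨(x, y), h⟩
  have term : ∀ q : ℤ × ℤ, (if h : q ∈ R then g ⟨q, h⟩ else 0)
      = ∑ b : R, if (b : ℤ × ℤ) = q then g b else 0 := by
    intro q
    split_ifs with hq
    · rw [Finset.sum_eq_single ⟨q, hq⟩]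
      · simp
      · intro b _ hb
        rw [if_neg]
        intro e
        exact hb (Subtype.ext e)
      · simp
    · symm
      apply Finset.sum_eq_zero
      intro b _
      rw [if_neg]
      rintro rfl
      exact hq b.2
  simp only
  rw [term (x+1, y), term (x-1, y), term (x, y+1), term (x, y-1), ← Finset.sum_add_distrib,
    ← Finset.sum_add_distrib, ← Finset.sum_add_distrib]
  rw [Pi.zero_apply] at h0
  refine Eq.trans ?_ h0
  simp only [Matrix.mulVec, dotProduct, adjM]
  apply Finset.sum_congr rfl
  rintro ⟨⟨a, b⟩, hb⟩ _
  simp only [Prod.mk.injEq, ite_mul, one_mul, zero_mul]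
  by_cases c1 : a = x + 1 ∧ b = y
  · rw [if_pos c1, if_neg (by omega), if_neg (by omega), if_neg (by omega), if_pos (by unfold Adjacent; dsimp only; omega)]
    simp
  by_cases c2 : a = x - 1 ∧ b = y
  · rw [if_neg c1, if_pos c2, if_neg (by omega), if_neg (by omega), if_pos (by unfold Adjacent; dsimp only; omega)]
    simp
  by_cases c3 : a = x ∧ b = y + 1
  · rw [if_neg c1, if_neg c2, if_pos c3, if_neg (by omega), if_pos (by unfold Adjacent; dsimp only; omega)]
    simp
  by_cases c4 : a = x ∧ b = y - 1
  · rw [if_neg c1, if_neg c2, if_neg c3, if_pos c4, if_pos (by unfold Adjacent; dsimp only; omega)]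
    simp
  · rw [if_neg c1, if_neg c2, if_neg c3, if_neg c4, if_neg (by unfold Adjacent; dsimp only; omega)]
    simp

theorem D_k_k1_odd (k p : ℕ) (hk : 0 < k) (hp : 0 < p) :
    Odd (numTilings (Dreg k (k + 1) p)) := by
  classical
  haveI : Fintype (Dreg k (k + 1) p) := (finite_Dreg k p hk hp).fintype
  rw [← ZMod.natCast_ne_zero_iff_odd]
  have := det_adjM (Dreg k (k + 1) p)
  intro h0
  have hdet : (adjM (Dreg k (k + 1) p)).det = 0 := by
    rw [← h0, ← this]
  haveI : Fact (Nat.Prime 2) := ⟨Nat.prime_two⟩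
  obtain ⟨g, hg, hg0⟩ := Matrix.exists_mulVec_eq_zero_iff.2 hdet
  apply hg
  ext1 ⟨⟨x, y⟩, hq⟩
  have := ker_trivial k p hk hp _ (inKer_of_mulVec _ g hg0) x y
  simpa [hq] using this
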